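/- Main asymptotic estimate (Theorem 3.4): Let u_ε be the classical solution of the convection–diffusion network problem on [0,T] with data (u₀, g) and diffusion coefficients ε^e, and let u be the classical solution of the corresponding limiting transport network problem with the same data (inflow boundary data g^v for v ∈ V∂^in, and with û^v(t) := g^v(t) additionally defined at outflow boundary vertices v ∈ V∂^out). Then there is a constant C, independent of the diffusion coefficients 0 < ε^e ≤ 1, such that sup_{t∈[0,T]} ( ∑_{e∈E} ∫₀^{ℓ^e} (u_ε^e(x,t) − u^e(x,t))² dx )^{1/2} ≤ C √ε, where ε := max_{e∈E} ε^e. -/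

import Mathlib

open Set Finset

/-- Coordinate of vertex `v` on edge `e`: `0` at the start vertex, `ℓ e` at the end vertex. -/
def endCoord {E V : Type} [DecidableEq V] (src : E → V) (ℓ : E → ℝ) (e : E) (v : V) : ℝ :=
  if src e = v then 0 else ℓ e

/-- Signed incidence number `n^e(v)`: `-1` at the start vertex, `+1` at the end vertex,
`0` otherwise. -/
def inc {E V : Type} [DecidableEq V] (src tgt : E → V) (e : E) (v : V) : ℝ :=
  (if tgt e = v then (1 : ℝ) else 0) - (if src e = v then (1 : ℝ) else 0)

/-- Number of edges incident to the vertex `v`. -/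
def edgeDeg {E V : Type} [Fintype E] [DecidableEq V] (src tgt : E → V) (v : V) : ℕ :=
  (Finset.univ.filter (fun e => src e = v ∨ tgt e = v)).card

/-- A classical solution of the convection–diffusion problem on the network with edges `E`,
vertices `V`, edge lengths `ℓ`, coefficients `a`, `b`, diffusion `eps`, time horizon `T`,
initial data `u0` and boundary data `g`.  The fields `ux`, `uxx`, `ut` are the spatial and
temporal derivatives of `u`, and `uhat` are the common nodal values. -/
structure CDSol (E V : Type) [Fintype E] [Fintype V] [DecidableEq E] [DecidableEq V]
    (src tgt : E → V) (ℓ a b eps : E → ℝ) (T : ℝ)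
    (u0 : E → ℝ → ℝ) (g : V → ℝ → ℝ) : Type where
  u : E → ℝ → ℝ → ℝ
  ux : E → ℝ → ℝ → ℝ
  uxx : E → ℝ → ℝ → ℝ
  ut : E → ℝ → ℝ → ℝ
  uhat : V → ℝ → ℝ
  cont_u : ∀ e, ContinuousOn (fun p : ℝ × ℝ => u e p.1 p.2) (Set.Icc 0 (ℓ e) ×ˢ Set.Icc 0 T)
  cont_ux : ∀ e, ContinuousOn (fun p : ℝ × ℝ => ux e p.1 p.2) (Set.Icc 0 (ℓ e) ×ˢ Set.Icc 0 T)
  cont_uxx : ∀ e, ContinuousOn (fun p : ℝ × ℝ => uxx e p.1 p.2) (Set.Icc 0 (ℓ e) ×ˢ Set.Icc 0 T)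
  cont_ut : ∀ e, ContinuousOn (fun p : ℝ × ℝ => ut e p.1 p.2) (Set.Icc 0 (ℓ e) ×ˢ Set.Icc 0 T)
  hasDeriv_x : ∀ e, ∀ t ∈ Set.Icc (0 : ℝ) T, ∀ x ∈ Set.Icc (0 : ℝ) (ℓ e),
      HasDerivWithinAt (fun y => u e y t) (ux e x t) (Set.Icc 0 (ℓ e)) x
  hasDeriv_xx : ∀ e, ∀ t ∈ Set.Icc (0 : ℝ) T, ∀ x ∈ Set.Icc (0 : ℝ) (ℓ e),
      HasDerivWithinAt (fun y => ux e y t) (uxx e x t) (Set.Icc 0 (ℓ e)) x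
  hasDeriv_t : ∀ e, ∀ x ∈ Set.Icc (0 : ℝ) (ℓ e), ∀ t ∈ Set.Icc (0 : ℝ) T,
      HasDerivWithinAt (fun s => u e x s) (ut e x t) (Set.Icc 0 T) t
  pde : ∀ e, ∀ x ∈ Set.Icc (0 : ℝ) (ℓ e), ∀ t ∈ Set.Icc (0 : ℝ) T,
      a e * ut e x t + b e * ux e x t = eps e * uxx e x t
  vertex_continuity : ∀ (v : V) (e : E), (src e = v ∨ tgt e = v) → ∀ t ∈ Set.Icc (0 : ℝ) T,
      u e (endCoord src ℓ e v) t = uhat v t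
  coupling : ∀ v : V, 2 ≤ edgeDeg src tgt v → ∀ t ∈ Set.Icc (0 : ℝ) T,
      ∑ e, (b e * u e (endCoord src ℓ e v) t - eps e * ux e (endCoord src ℓ e v) t)
        * inc src tgt e v = 0
  bdry : ∀ v : V, edgeDeg src tgt v = 1 → ∀ t ∈ Set.Icc (0 : ℝ) T, uhat v t = g v t
  init : ∀ e, ∀ x ∈ Set.Icc (0 : ℝ) (ℓ e), u e x 0 = u0 e x
/-- A classical solution of the transport problem on the network with edges `E`,
vertices `V`, edge lengths `ℓ`, coefficients `a`, `b`, time horizon `T`, initial data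
`u0` and inflow boundary data `g`.  The fields `ux`, `ut` are the spatial and temporal
derivatives of `u` and `uhat` are the nodal values (only relevant at vertices that are
not outflow boundary vertices). -/
structure TSol (E V : Type) [Fintype E] [Fintype V] [DecidableEq E] [DecidableEq V]
    (src tgt : E → V) (ℓ a b : E → ℝ) (T : ℝ)
    (u0 : E → ℝ → ℝ) (g : V → ℝ → ℝ) : Type where
  u : E → ℝ → ℝ → ℝ
  ux : E → ℝ → ℝ → ℝ
  ut : E → ℝ → ℝ → ℝ
  uhat : V → ℝ → ℝ
  cont_u : ∀ e, ContinuousOn (fun p : ℝ × ℝ => u e p.1 p.2) (Set.Icc 0 (ℓ e) ×ˢ Set.Icc 0 T)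
  cont_ux : ∀ e, ContinuousOn (fun p : ℝ × ℝ => ux e p.1 p.2) (Set.Icc 0 (ℓ e) ×ˢ Set.Icc 0 T)
  cont_ut : ∀ e, ContinuousOn (fun p : ℝ × ℝ => ut e p.1 p.2) (Set.Icc 0 (ℓ e) ×ˢ Set.Icc 0 T)
  hasDeriv_x : ∀ e, ∀ t ∈ Set.Icc (0 : ℝ) T, ∀ x ∈ Set.Icc (0 : ℝ) (ℓ e),
      HasDerivWithinAt (fun y => u e y t) (ux e x t) (Set.Icc 0 (ℓ e)) x
  hasDeriv_t : ∀ e, ∀ x ∈ Set.Icc (0 : ℝ) (ℓ e), ∀ t ∈ Set.Icc (0 : ℝ) T,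
      HasDerivWithinAt (fun s => u e x s) (ut e x t) (Set.Icc 0 T) t
  pde : ∀ e, ∀ x ∈ Set.Icc (0 : ℝ) (ℓ e), ∀ t ∈ Set.Icc (0 : ℝ) T,
      a e * ut e x t + b e * ux e x t = 0
  inflow_value : ∀ (e : E), ∀ t ∈ Set.Icc (0 : ℝ) T, u e 0 t = uhat (src e) t
  coupling : ∀ v : V, 2 ≤ edgeDeg src tgt v → ∀ t ∈ Set.Icc (0 : ℝ) T,
      ∑ e ∈ Finset.univ.filter (fun e => tgt e = v), b e * u e (ℓ e) t
        = (∑ e ∈ Finset.univ.filter (fun e => src e = v), b e) * uhat v t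
  bdry_in : ∀ v : V, edgeDeg src tgt v = 1 → (∃ e, src e = v) →
      ∀ t ∈ Set.Icc (0 : ℝ) T, uhat v t = g v t
  init : ∀ e, ∀ x ∈ Set.Icc (0 : ℝ) (ℓ e), u e x 0 = u0 e x

/-- Boundary layer profile on `[0, L]` with decay rate `c`: it vanishes at `0`, equals `1` at `L`
and decays exponentially away from `L`. -/
noncomputable def boundaryLayer (L c x : ℝ) : ℝ := x / L * Real.exp (-(c * (L - x)))

lemma boundaryLayer_zero (L c : ℝ) : boundaryLayer L c 0 = 0 := by simp [boundaryLayer]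

lemma boundaryLayer_self {L : ℝ} (hL : L ≠ 0) (c : ℝ) : boundaryLayer L c L = 1 := by
  simp [boundaryLayer, hL]

lemma hasDerivAt_exp_layer (L c x : ℝ) :
    HasDerivAt (fun y => Real.exp (-(c * (L - y)))) (c * Real.exp (-(c * (L - x)))) x := by
  have h : HasDerivAt (fun y => -(c * (L - y))) c x := by
    simpa using (((hasDerivAt_id x).const_sub L).const_mul c).fun_neg
  simpa [mul_comm] using h.exp

lemma hasDerivAt_boundaryLayer (L c x : ℝ) :
    HasDerivAt (boundaryLayer L c)
      (Real.exp (-(c * (L - x))) / L + c * boundaryLayer L c x) x := by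
  have h := ((hasDerivAt_id x).div_const L).mul (hasDerivAt_exp_layer L c x)
  refine h.congr_deriv ?_
  simp only [boundaryLayer, id]
  ring

lemma continuous_boundaryLayer (L c : ℝ) : Continuous (boundaryLayer L c) := by
  unfold boundaryLayer
  fun_prop

lemma boundaryLayer_nonneg {L c x : ℝ} (hL : 0 < L) (hx : 0 ≤ x) : 0 ≤ boundaryLayer L c x := by
  unfold boundaryLayer
  positivity

lemma exp_layer_le_one {L c x : ℝ} (hc : 0 ≤ c) (hx : x ≤ L) :
    Real.exp (-(c * (L - x))) ≤ 1 := by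
  rw [Real.exp_le_one_iff]
  nlinarith [mul_nonneg hc (sub_nonneg.2 hx)]

lemma boundaryLayer_sq_le {L c x : ℝ} (hL : 0 < L) (hc : 0 ≤ c) (hx : x ∈ Set.Icc 0 L) :
    boundaryLayer L c x ^ 2 ≤ Real.exp (-(c * (L - x))) := by
  have h1 := exp_layer_le_one hc hx.2
  have h2 := Real.exp_pos (-(c * (L - x)))
  have h3 : x / L ≤ 1 := (div_le_one hL).2 hx.2
  have h4 : 0 ≤ x / L := div_nonneg hx.1 hL.le
  have h5 : boundaryLayer L c x ≤ Real.exp (-(c * (L - x))) := by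
    unfold boundaryLayer
    nlinarith
  have h6 := boundaryLayer_nonneg (c := c) hL hx.1
  nlinarith

lemma integral_exp_layer_le (L : ℝ) {c : ℝ} (hc : 0 < c) :
    ∫ x in (0 : ℝ)..L, Real.exp (-(c * (L - x))) ≤ 1 / c := by
  have hcont : Continuous fun x => Real.exp (-(c * (L - x))) := by fun_prop
  have h := intervalIntegral.integral_eq_sub_of_hasDerivAt (a := 0) (b := L)
    (f := fun x => Real.exp (-(c * (L - x))) / c)
    (f' := fun x => Real.exp (-(c * (L - x))))
    (fun x _ => ((hasDerivAt_exp_layer L c x).div_const c).congr_deriv (by field_simp))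
    (hcont.intervalIntegrable _ _)
  rw [h]
  have : 0 ≤ Real.exp (-(c * (L - 0))) / c := by positivity
  simp only [sub_self, mul_zero, neg_zero, Real.exp_zero]
  linarith

lemma integral_boundaryLayer_sq_le {L c : ℝ} (hL : 0 < L) (hc : 0 < c) :
    ∫ x in (0 : ℝ)..L, boundaryLayer L c x ^ 2 ≤ 1 / c := by
  refine le_trans (intervalIntegral.integral_mono_on hL.le ?_ ?_
    fun x hx => boundaryLayer_sq_le hL hc.le hx) (integral_exp_layer_le L hc)
  · exact ((continuous_boundaryLayer L c).pow 2).intervalIntegrable _ _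
  · exact Continuous.intervalIntegrable (by fun_prop) _ _

/-- Pointwise form of the energy estimate for the corrected error `ψ` on an edge. -/
lemma energy_integrand_le {a b eps L M d d' E k k' ψ p Ux Uxx Ut vx vt : ℝ}
    (ha : 0 < a) (heps : 0 < eps) (hL : 0 < L)
    (hE0 : 0 ≤ E) (hE1 : E ≤ 1) (hk : k ^ 2 ≤ E) (hk' : k' = E / L + b / eps * k)
    (hp : p = Ux - vx - d * k')
    (hU : a * Ut + b * Ux = eps * Uxx) (hv : a * vt + b * vx = 0)
    (hvx : |vx| ≤ M) (hd : |d| ≤ M) (hd' : |d'| ≤ M) :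
    2 * a * ψ * (Ut - vt - d' * k) ≤
      (2 * eps * (p * Ux + ψ * Uxx) - b * (2 * ψ * p) - 2 * b * d * (p * k + ψ * k'))
        + (a * ψ ^ 2 + (eps * ((M + M / L) ^ 2 / 2) + a * M ^ 2 * E)) := by
  have hM : 0 ≤ M := (abs_nonneg _).trans hd
  have hek : eps * k' = eps * (E / L) + b * k := by
    rw [hk']
    field_simp
  have hq : |vx + d * (E / L)| ≤ M + M / L := by
    refine (abs_add_le _ _).trans (add_le_add hvx ?_)
    rw [abs_mul, abs_of_nonneg (div_nonneg hE0 hL.le), div_eq_mul_one_div M]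
    gcongr
  have hq2 : (vx + d * (E / L)) ^ 2 ≤ (M + M / L) ^ 2 :=
    sq_le_sq' (by linarith [neg_abs_le (vx + d * (E / L))])
      (by linarith [le_abs_self (vx + d * (E / L))])
  have hd2 : d' ^ 2 ≤ M ^ 2 :=
    sq_le_sq' (by linarith [neg_abs_le d']) (by linarith [le_abs_self d'])
  have hdk : d' ^ 2 * k ^ 2 ≤ M ^ 2 * E := by gcongr
  have key : 2 * a * ψ * (Ut - vt - d' * k) =
      (2 * eps * (p * Ux + ψ * Uxx) - b * (2 * ψ * p) - 2 * b * d * (p * k + ψ * k'))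
        - 2 * eps * p ^ 2 - 2 * eps * p * (vx + d * (E / L)) - 2 * a * d' * ψ * k := by
    have h1 : a * Ut = eps * Uxx - b * Ux := by linarith
    have h2 : a * vt = - b * vx := by linarith
    have h3 : Ux = p + vx + d * k' := by linarith
    linear_combination 2 * ψ * h1 - 2 * ψ * h2 + (-2 * b * ψ - 2 * eps * p) * h3 - 2 * p * d * hek
  rw [key]
  nlinarith [mul_nonneg heps.le (sq_nonneg (2 * p + (vx + d * (E / L)))),
    mul_le_mul_of_nonneg_left hq2 heps.le, mul_le_mul_of_nonneg_left hdk ha.le,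
    mul_nonneg ha.le (sq_nonneg (ψ + d' * k))]

/-- Energy estimate on one edge at a fixed time, with boundary terms. -/
lemma edge_energy_le {a b eps L M d d' : ℝ} {U Ux Uxx Ut v vx vt : ℝ → ℝ}
    (ha : 0 < a) (hb : 0 < b) (heps : 0 < eps) (hL : 0 < L)
    (cU : ContinuousOn U (Set.Icc 0 L)) (cUx : ContinuousOn Ux (Set.Icc 0 L))
    (cUxx : ContinuousOn Uxx (Set.Icc 0 L)) (cUt : ContinuousOn Ut (Set.Icc 0 L))
    (cv : ContinuousOn v (Set.Icc 0 L)) (cvx : ContinuousOn vx (Set.Icc 0 L))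
    (cvt : ContinuousOn vt (Set.Icc 0 L))
    (dU : ∀ x ∈ Set.Icc 0 L, HasDerivWithinAt U (Ux x) (Set.Icc 0 L) x)
    (dUx : ∀ x ∈ Set.Icc 0 L, HasDerivWithinAt Ux (Uxx x) (Set.Icc 0 L) x)
    (dv : ∀ x ∈ Set.Icc 0 L, HasDerivWithinAt v (vx x) (Set.Icc 0 L) x)
    (hU : ∀ x ∈ Set.Icc 0 L, a * Ut x + b * Ux x = eps * Uxx x)
    (hv : ∀ x ∈ Set.Icc 0 L, a * vt x + b * vx x = 0)
    (hvx : ∀ x ∈ Set.Icc 0 L, |vx x| ≤ M) (hd : |d| ≤ M) (hd' : |d'| ≤ M) :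
    ∫ x in (0 : ℝ)..L, 2 * a * (U x - v x - d * boundaryLayer L (b / eps) x) *
        (Ut x - vt x - d' * boundaryLayer L (b / eps) x) ≤
      (2 * eps * Ux L * (U L - v L - d) - b * (U L - v L - d) ^ 2 - 2 * b * d * (U L - v L - d))
        - (2 * eps * Ux 0 * (U 0 - v 0) - b * (U 0 - v 0) ^ 2)
        + ((∫ x in (0 : ℝ)..L, a * (U x - v x - d * boundaryLayer L (b / eps) x) ^ 2)
          + eps * (L * ((M + M / L) ^ 2 / 2) + a * M ^ 2 / b)) := by
  set c := b / eps with hc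
  have hcpos : 0 < c := div_pos hb heps
  set k := boundaryLayer L c with hk
  have ck : ContinuousOn k (Set.Icc 0 L) := (continuous_boundaryLayer L c).continuousOn
  set k' : ℝ → ℝ := fun x => Real.exp (-(c * (L - x))) / L + c * k x with hk'
  have cE : ContinuousOn (fun x => Real.exp (-(c * (L - x)))) (Set.Icc 0 L) :=
    Continuous.continuousOn (by fun_prop)
  have ck' : ContinuousOn k' (Set.Icc 0 L) := by
    simp only [hk']
    fun_prop
  set ψ : ℝ → ℝ := fun x => U x - v x - d * k x with hψ
  set p : ℝ → ℝ := fun x => Ux x - vx x - d * k' x with hp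
  have cψ : ContinuousOn ψ (Set.Icc 0 L) := by
    simp only [hψ]
    fun_prop
  have cp : ContinuousOn p (Set.Icc 0 L) := by
    simp only [hp]
    fun_prop
  set G : ℝ → ℝ := fun x => 2 * eps * (ψ x * Ux x) - b * ψ x ^ 2 - 2 * b * d * (ψ x * k x) with hG
  set G' : ℝ → ℝ := fun x => 2 * eps * (p x * Ux x + ψ x * Uxx x) - b * (2 * ψ x * p x)
    - 2 * b * d * (p x * k x + ψ x * k' x) with hG'
  have cG : ContinuousOn G (Set.Icc 0 L) := by
    simp only [hG]
    fun_prop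
  have cG' : ContinuousOn G' (Set.Icc 0 L) := by
    simp only [hG']
    fun_prop
  have integ : ∀ {f : ℝ → ℝ}, ContinuousOn f (Set.Icc 0 L) →
      IntervalIntegrable f MeasureTheory.volume 0 L := fun h =>
    ContinuousOn.intervalIntegrable (by rwa [Set.uIcc_of_le hL.le])
  have ftc : ∫ x in (0 : ℝ)..L, G' x = G L - G 0 := by
    refine intervalIntegral.integral_eq_sub_of_hasDerivAt_of_le hL.le cG (fun x hx => ?_)
      (integ cG')
    have hx' := Set.Ioo_subset_Icc_self hx
    have hn : Set.Icc 0 L ∈ nhds x := Icc_mem_nhds hx.1 hx.2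
    have h1 := (dU x hx').hasDerivAt hn
    have h2 := (dUx x hx').hasDerivAt hn
    have h3 := (dv x hx').hasDerivAt hn
    have h4 : HasDerivAt k (k' x) x := hasDerivAt_boundaryLayer L c x
    have h5 : HasDerivAt ψ (p x) x := (h1.sub h3).sub (h4.const_mul d)
    have h6 := (((h5.mul h2).const_mul (2 * eps)).sub ((h5.pow 2).const_mul b)).sub
      ((h5.mul h4).const_mul (2 * b * d))
    exact h6.congr_deriv (by simp [hG'])
  have hψ0 : ψ 0 = U 0 - v 0 := by simp [hψ, hk, boundaryLayer_zero]
  have hψL : ψ L = U L - v L - d := by simp [hψ, hk, boundaryLayer_self hL.ne']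
  have hGL : G L - G 0 = (2 * eps * Ux L * (U L - v L - d) - b * (U L - v L - d) ^ 2
      - 2 * b * d * (U L - v L - d)) - (2 * eps * Ux 0 * (U 0 - v 0) - b * (U 0 - v 0) ^ 2) := by
    simp only [hG, hψ0, hψL, hk, boundaryLayer_zero, boundaryLayer_self hL.ne']
    ring
  rw [← hGL, ← ftc]
  have cAψ : ContinuousOn (fun x => a * ψ x ^ 2) (Set.Icc 0 L) := by fun_prop
  have cR : ContinuousOn (fun x => eps * ((M + M / L) ^ 2 / 2)
      + a * M ^ 2 * Real.exp (-(c * (L - x)))) (Set.Icc 0 L) := by fun_prop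
  have hR : ∫ x in (0 : ℝ)..L, (eps * ((M + M / L) ^ 2 / 2)
      + a * M ^ 2 * Real.exp (-(c * (L - x)))) ≤
      eps * (L * ((M + M / L) ^ 2 / 2) + a * M ^ 2 / b) := by
    rw [intervalIntegral.integral_add (by simp) (integ (by fun_prop)),
      intervalIntegral.integral_const, intervalIntegral.integral_const_mul]
    have h := mul_le_mul_of_nonneg_left (integral_exp_layer_le L hcpos)
      (by positivity : 0 ≤ a * M ^ 2)
    have hce : 1 / c = eps / b := by rw [hc, one_div_div]
    rw [hce] at h
    calc _ ≤ (L - 0) • (eps * ((M + M / L) ^ 2 / 2)) + a * M ^ 2 * (eps / b) := by gcongr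
      _ = _ := by
        rw [smul_eq_mul]
        ring
  calc _ ≤ ∫ x in (0 : ℝ)..L, (G' x + (a * ψ x ^ 2 + (eps * ((M + M / L) ^ 2 / 2)
      + a * M ^ 2 * Real.exp (-(c * (L - x)))))) := by
        refine intervalIntegral.integral_mono_on hL.le (integ (by fun_prop)) (integ (by fun_prop))
          fun x hx => ?_
        exact energy_integrand_le ha heps hL (Real.exp_pos _).le (exp_layer_le_one hcpos.le hx.2)
          (boundaryLayer_sq_le hL hcpos.le hx) rfl rfl (hU x hx) (hv x hx) (hvx x hx) hd hd'
    _ ≤ _ := by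
        rw [intervalIntegral.integral_add (integ cG') (integ (by fun_prop)),
          intervalIntegral.integral_add (integ cAψ) (integ cR)]
        gcongr

lemma continuousOn_integral_of_continuousOn_prod {L T : ℝ} {F : ℝ → ℝ → ℝ} (hL : 0 ≤ L)
    (hF : ContinuousOn (fun p : ℝ × ℝ => F p.1 p.2) (Set.Icc 0 L ×ˢ Set.Icc 0 T)) :
    ContinuousOn (fun t => ∫ x in (0 : ℝ)..L, F x t) (Set.Icc 0 T) := by
  intro t ht
  obtain ⟨C, hC⟩ := (isCompact_Icc.prod isCompact_Icc).exists_bound_of_continuousOn hF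
  have hsub : Set.uIoc 0 L ⊆ Set.Icc 0 L := by
    rw [Set.uIoc_of_le hL]
    exact Set.Ioc_subset_Icc_self
  refine intervalIntegral.continuousWithinAt_of_dominated_interval (bound := fun _ => C)
    ?_ ?_ (by simp) ?_
  · filter_upwards [self_mem_nhdsWithin] with s hs
    refine ContinuousOn.aestronglyMeasurable ?_ measurableSet_uIoc
    exact hF.comp (f := fun x => (x, s)) (by fun_prop) fun x hx => ⟨hsub hx, hs⟩
  · filter_upwards [self_mem_nhdsWithin] with s hs
    exact Filter.Eventually.of_forall fun x hx => hC (x, s) ⟨hsub hx, hs⟩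
  · refine Filter.Eventually.of_forall fun x hx => ?_
    exact (hF.comp (f := fun s => (x, s)) (by fun_prop) fun s hs => ⟨hsub hx, hs⟩) t ht

lemma hasDerivAt_integral_of_continuousOn_prod {L T t : ℝ} {F F' : ℝ → ℝ → ℝ} (hL : 0 ≤ L)
    (hF : ContinuousOn (fun p : ℝ × ℝ => F p.1 p.2) (Set.Icc 0 L ×ˢ Set.Icc 0 T))
    (hF' : ContinuousOn (fun p : ℝ × ℝ => F' p.1 p.2) (Set.Icc 0 L ×ˢ Set.Icc 0 T))
    (hd : ∀ x ∈ Set.Icc 0 L, ∀ s ∈ Set.Icc 0 T,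
      HasDerivWithinAt (fun r => F x r) (F' x s) (Set.Icc 0 T) s)
    (ht : t ∈ Set.Ioo 0 T) :
    HasDerivAt (fun s => ∫ x in (0 : ℝ)..L, F x s) (∫ x in (0 : ℝ)..L, F' x t) t := by
  obtain ⟨C, hC⟩ := (isCompact_Icc.prod isCompact_Icc).exists_bound_of_continuousOn hF'
  have hsub : Set.uIoc 0 L ⊆ Set.Icc 0 L := by
    rw [Set.uIoc_of_le hL]
    exact Set.Ioc_subset_Icc_self
  have slice : ∀ {f : ℝ → ℝ → ℝ},
      ContinuousOn (fun p : ℝ × ℝ => f p.1 p.2) (Set.Icc 0 L ×ˢ Set.Icc 0 T) →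
      ∀ s ∈ Set.Icc 0 T, ContinuousOn (fun x => f x s) (Set.Icc 0 L) := fun hf s hs =>
    hf.comp (f := fun x => (x, s)) (by fun_prop) fun x hx => ⟨hx, hs⟩
  have ht' := Set.Ioo_subset_Icc_self ht
  have hn : Set.Ioo 0 T ∈ nhds t := Ioo_mem_nhds ht.1 ht.2
  refine (intervalIntegral.hasDerivAt_integral_of_dominated_loc_of_deriv_le (𝕜 := ℝ)
    (F := fun s x => F x s) (F' := fun s x => F' x s) (bound := fun _ => C) hn
    ?_ ?_ ?_ ?_ (by simp) ?_).2
  · filter_upwards [hn] with s hs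
    exact ((slice hF s (Set.Ioo_subset_Icc_self hs)).mono hsub).aestronglyMeasurable
      measurableSet_uIoc
  · refine ContinuousOn.intervalIntegrable ?_
    rw [Set.uIcc_of_le hL]
    exact slice hF t ht'
  · exact ((slice hF' t ht').mono hsub).aestronglyMeasurable measurableSet_uIoc
  · exact Filter.Eventually.of_forall fun x hx s hs =>
      hC (x, s) ⟨hsub hx, Set.Ioo_subset_Icc_self hs⟩
  · exact Filter.Eventually.of_forall fun x hx s hs =>
      (hd x (hsub hx) s (Set.Ioo_subset_Icc_self hs)).hasDerivAt (Icc_mem_nhds hs.1 hs.2)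

/-- Grönwall's inequality for `y' ≤ y + K` with `y 0 = 0`. -/
lemma le_mul_exp_of_deriv_le {y y' : ℝ → ℝ} {K T t : ℝ} (hy : ContinuousOn y (Set.Icc 0 T))
    (hd : ∀ s ∈ Set.Ioo 0 T, HasDerivAt y (y' s) s) (hle : ∀ s ∈ Set.Ioo 0 T, y' s ≤ y s + K)
    (h0 : y 0 = 0) (hK : 0 ≤ K) (ht : t ∈ Set.Icc 0 T) : y t ≤ K * Real.exp T := by
  have hz : ∀ s ∈ Set.Ioo 0 T, HasDerivAt (fun r => Real.exp (-r) * (y r + K))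
      (Real.exp (-s) * (-1) * (y s + K) + Real.exp (-s) * y' s) s := fun s hs =>
    ((hasDerivAt_neg s).exp).mul ((hd s hs).add_const K)
  have hanti : AntitoneOn (fun r => Real.exp (-r) * (y r + K)) (Set.Icc 0 T) := by
    refine antitoneOn_of_deriv_nonpos (convex_Icc 0 T) (by fun_prop) ?_ ?_
    · rw [interior_Icc]
      exact fun s hs => (hz s hs).differentiableAt.differentiableWithinAt
    · rw [interior_Icc]
      intro s hs
      rw [(hz s hs).deriv]
      nlinarith [Real.exp_pos (-s), hle s hs]
  have h := hanti ⟨le_rfl, ht.1.trans ht.2⟩ ht ht.1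
  simp only [neg_zero, Real.exp_zero, h0, zero_add, one_mul] at h
  rw [Real.exp_neg, inv_mul_le_iff₀ (Real.exp_pos t)] at h
  have : Real.exp t * K ≤ Real.exp T * K := by
    have := Real.exp_le_exp.2 ht.2
    gcongr
  linarith

/-- Summation by parts on a network: edge boundary terms are regrouped by vertices. -/
lemma sum_edge_boundary_eq_sum_vertex {E V : Type} [Fintype E] [Fintype V] [DecidableEq V]
    {src tgt : E → V} {ℓ : E → ℝ} (hne : ∀ e, src e ≠ tgt e) (A : E → ℝ → ℝ) (φ : V → ℝ) :
    ∑ e, (A e (ℓ e) * φ (tgt e) - A e 0 * φ (src e)) =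
      ∑ v, φ v * ∑ e, A e (endCoord src ℓ e v) * inc src tgt e v := by
  simp_rw [Finset.mul_sum]
  rw [Finset.sum_comm]
  refine Finset.sum_congr rfl fun e _ => ?_
  have : ∀ v, φ v * (A e (endCoord src ℓ e v) * inc src tgt e v) =
      (if tgt e = v then A e (ℓ e) * φ v else 0) - (if src e = v then A e 0 * φ v else 0) := by
    intro v
    by_cases h1 : src e = v
    · have h2 : tgt e ≠ v := fun h => hne e (h1.trans h.symm)
      simp [endCoord, inc, h1, h2]
      ring
    · by_cases h2 : tgt e = v
      · simp [endCoord, inc, h1, h2]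
        ring
      · simp [inc, h1, h2]
  simp_rw [this, Finset.sum_sub_distrib, Finset.sum_ite_eq, Finset.mem_univ, if_true]

section Network

variable {E V : Type} [Fintype E] [Fintype V] [DecidableEq E] [DecidableEq V]
  {src tgt : E → V} {ℓ a b eps : E → ℝ} {T : ℝ} {u0 : E → ℝ → ℝ} {g : V → ℝ → ℝ}

/-- Nodal values of the transport solution, completed by the boundary data, are continuously
differentiable in time. -/
lemma TSol.exists_nodal_values (sol : TSol E V src tgt ℓ a b T u0 g) (hT : 0 < T)
    (hℓ : ∀ e, 0 < ℓ e)
    (hout : ∀ v : V, 2 ≤ edgeDeg src tgt v → ∃ e, src e = v)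
    (hg : ∀ v, ContDiffOn ℝ 2 (g v) (Set.Icc 0 T)) :
    ∃ h h' : V → ℝ → ℝ, (∀ v, ContinuousOn (h' v) (Set.Icc 0 T)) ∧
      (∀ v, ∀ t ∈ Set.Icc 0 T, HasDerivWithinAt (h v) (h' v t) (Set.Icc 0 T) t) ∧
      (∀ v, 2 ≤ edgeDeg src tgt v → ∀ t ∈ Set.Icc 0 T, h v t = sol.uhat v t) ∧
      (∀ v, edgeDeg src tgt v = 1 → ∀ t ∈ Set.Icc 0 T, h v t = g v t) := by
  have hv : ∀ v, ∃ h h' : ℝ → ℝ, ContinuousOn h' (Set.Icc 0 T) ∧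
      (∀ t ∈ Set.Icc 0 T, HasDerivWithinAt h (h' t) (Set.Icc 0 T) t) ∧
      (2 ≤ edgeDeg src tgt v → ∀ t ∈ Set.Icc 0 T, h t = sol.uhat v t) ∧
      (edgeDeg src tgt v = 1 → ∀ t ∈ Set.Icc 0 T, h t = g v t) := by
    intro v
    by_cases hd : 2 ≤ edgeDeg src tgt v
    · obtain ⟨e, rfl⟩ := hout v hd
      have h0 : (0 : ℝ) ∈ Set.Icc 0 (ℓ e) := ⟨le_rfl, (hℓ e).le⟩
      refine ⟨fun t => sol.u e 0 t, fun t => sol.ut e 0 t, ?_, sol.hasDeriv_t e 0 h0,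
        fun _ t ht => sol.inflow_value e t ht, fun h => by omega⟩
      exact (sol.cont_ut e).comp (f := fun t => ((0 : ℝ), t)) (by fun_prop) fun t ht => ⟨h0, ht⟩
    · refine ⟨g v, derivWithin (g v) (Set.Icc 0 T),
        (hg v).continuousOn_derivWithin (uniqueDiffOn_Icc hT) (by norm_num), fun t ht => ?_,
        fun h => absurd h hd, fun _ _ _ => rfl⟩
      exact (((hg v).differentiableOn (by norm_num)) t ht).hasDerivWithinAt
  choose h h' h1 h2 h3 h4 using hv
  exact ⟨h, h', h1, h2, h3, h4⟩

/-- The boundary terms of the edge energy estimates cancel after summation over the network. -/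
lemma sum_boundary_terms_eq_zero (hne : ∀ e, src e ≠ tgt e)
    (hdeg : ∀ v : V, 1 ≤ edgeDeg src tgt v)
    (hflow : ∀ v : V, 2 ≤ edgeDeg src tgt v → ∑ e, b e * inc src tgt e v = 0)
    (sol : TSol E V src tgt ℓ a b T u0 g) (soleps : CDSol E V src tgt ℓ a b eps T u0 g)
    {h : V → ℝ} {t : ℝ} (ht : t ∈ Set.Icc 0 T)
    (hin : ∀ v, 2 ≤ edgeDeg src tgt v → h v = sol.uhat v t)
    (hbd : ∀ v, edgeDeg src tgt v = 1 → h v = g v t)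
    {d : E → ℝ} (hd : ∀ e, d e = h (tgt e) - sol.u e (ℓ e) t) :
    ∑ e, ((2 * eps e * soleps.ux e (ℓ e) t * (soleps.u e (ℓ e) t - sol.u e (ℓ e) t - d e)
        - b e * (soleps.u e (ℓ e) t - sol.u e (ℓ e) t - d e) ^ 2
        - 2 * b e * d e * (soleps.u e (ℓ e) t - sol.u e (ℓ e) t - d e))
      - (2 * eps e * soleps.ux e 0 t * (soleps.u e 0 t - sol.u e 0 t)
        - b e * (soleps.u e 0 t - sol.u e 0 t) ^ 2)) = 0 := by
  set φ : V → ℝ := fun v => soleps.uhat v t - h v with hφ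
  have hφ1 : ∀ v, edgeDeg src tgt v = 1 → φ v = 0 := fun v hv => by
    simp [hφ, hbd v hv, soleps.bdry v hv t ht]
  have hcases : ∀ v, edgeDeg src tgt v = 1 ∨ 2 ≤ edgeDeg src tgt v := fun v => by
    have := hdeg v
    omega
  have hL : ∀ e, soleps.u e (ℓ e) t - sol.u e (ℓ e) t - d e = φ (tgt e) := fun e => by
    have := soleps.vertex_continuity (tgt e) e (Or.inr rfl) t ht
    rw [endCoord, if_neg (hne e)] at this
    rw [hd, this]
    ring
  have h0 : ∀ e, soleps.u e 0 t - sol.u e 0 t = φ (src e) := fun e => by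
    have := soleps.vertex_continuity (src e) e (Or.inl rfl) t ht
    rw [endCoord, if_pos rfl] at this
    rw [this, sol.inflow_value e t ht]
    rcases hcases (src e) with hv | hv
    · rw [sol.bdry_in _ hv ⟨e, rfl⟩ t ht, ← hbd _ hv]
    · rw [← hin _ hv]
  have flux : ∑ e, (eps e * soleps.ux e (ℓ e) t * φ (tgt e)
      - eps e * soleps.ux e 0 t * φ (src e)) = 0 := by
    rw [sum_edge_boundary_eq_sum_vertex hne (fun e x => eps e * soleps.ux e x t) φ]
    refine Finset.sum_eq_zero fun v _ => ?_
    rcases hcases v with hv | hv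
    · rw [hφ1 v hv, zero_mul]
    · have hc := soleps.coupling v hv t ht
      have hu : ∑ e, b e * soleps.u e (endCoord src ℓ e v) t * inc src tgt e v = 0 := by
        have : ∀ e, b e * soleps.u e (endCoord src ℓ e v) t * inc src tgt e v =
            soleps.uhat v t * (b e * inc src tgt e v) := fun e => by
          by_cases hev : src e = v ∨ tgt e = v
          · rw [soleps.vertex_continuity v e hev t ht]
            ring
          · rw [not_or] at hev
            simp [inc, hev.1, hev.2]
        simp_rw [this, ← Finset.mul_sum, hflow v hv, mul_zero]
      simp_rw [sub_mul, Finset.sum_sub_distrib, hu] at hc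
      rw [zero_sub, neg_eq_zero] at hc
      rw [hc, mul_zero]
  have conv : ∑ e, (b e * φ (tgt e) ^ 2 - b e * φ (src e) ^ 2) = 0 := by
    rw [sum_edge_boundary_eq_sum_vertex (ℓ := ℓ) hne (fun e _ => b e) (fun v => φ v ^ 2)]
    refine Finset.sum_eq_zero fun v _ => ?_
    rcases hcases v with hv | hv
    · simp [hφ1 v hv]
    · rw [hflow v hv, mul_zero]
  have jump : ∑ e, b e * d e * φ (tgt e) = 0 := by
    rw [← Finset.sum_fiberwise (s := Finset.univ) (g := tgt)]
    refine Finset.sum_eq_zero fun v _ => ?_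
    have : ∀ e ∈ Finset.univ.filter (fun e => tgt e = v),
        b e * d e * φ (tgt e) = (b e * h v - b e * sol.u e (ℓ e) t) * φ v := fun e he => by
      rw [hd, (Finset.mem_filter.1 he).2]
      ring
    rw [Finset.sum_congr rfl this, ← Finset.sum_mul]
    rcases hcases v with hv | hv
    · rw [hφ1 v hv, mul_zero]
    · have hf := hflow v hv
      simp_rw [inc, mul_sub, mul_ite, mul_one, mul_zero, Finset.sum_sub_distrib,
        ← Finset.sum_filter] at hf
      rw [Finset.sum_sub_distrib, sol.coupling v hv t ht, ← Finset.sum_mul, hin v hv, ← sub_mul,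
        hf, zero_mul, zero_mul]
  simp_rw [hL, h0]
  calc _ = 2 * ∑ e, (eps e * soleps.ux e (ℓ e) t * φ (tgt e)
            - eps e * soleps.ux e 0 t * φ (src e))
          - ∑ e, (b e * φ (tgt e) ^ 2 - b e * φ (src e) ^ 2)
          - 2 * ∑ e, b e * d e * φ (tgt e) := by
        simp_rw [Finset.mul_sum, ← Finset.sum_sub_distrib]
        exact Finset.sum_congr rfl fun e _ => by ring
    _ = 0 := by rw [flux, conv, jump]; ring

/-- Energy estimate for the error between the convection–diffusion solution and the transport
solution corrected by boundary layers with amplitudes `d`. -/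
lemma corrected_error_energy_le (hne : ∀ e, src e ≠ tgt e)
    (hℓ : ∀ e, 0 < ℓ e) (ha : ∀ e, 0 < a e) (hb : ∀ e, 0 < b e) (heps : ∀ e, 0 < eps e)
    (hdeg : ∀ v : V, 1 ≤ edgeDeg src tgt v)
    (hflow : ∀ v : V, 2 ≤ edgeDeg src tgt v → ∑ e, b e * inc src tgt e v = 0)
    (sol : TSol E V src tgt ℓ a b T u0 g) (soleps : CDSol E V src tgt ℓ a b eps T u0 g)
    {h : V → ℝ → ℝ} {d d' : E → ℝ → ℝ} {M : E → ℝ}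
    (hin : ∀ v, 2 ≤ edgeDeg src tgt v → ∀ t ∈ Set.Icc 0 T, h v t = sol.uhat v t)
    (hbd : ∀ v, edgeDeg src tgt v = 1 → ∀ t ∈ Set.Icc 0 T, h v t = g v t)
    (hd : ∀ e t, d e t = h (tgt e) t - sol.u e (ℓ e) t) (hd0 : ∀ e, d e 0 = 0)
    (cd' : ∀ e, ContinuousOn (d' e) (Set.Icc 0 T))
    (dd : ∀ e, ∀ t ∈ Set.Icc 0 T, HasDerivWithinAt (d e) (d' e t) (Set.Icc 0 T) t)
    (hMx : ∀ e, ∀ t ∈ Set.Icc 0 T, ∀ x ∈ Set.Icc 0 (ℓ e), |sol.ux e x t| ≤ M e)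
    (hMd : ∀ e, ∀ t ∈ Set.Icc 0 T, |d e t| ≤ M e)
    (hMd' : ∀ e, ∀ t ∈ Set.Icc 0 T, |d' e t| ≤ M e)
    {t : ℝ} (ht : t ∈ Set.Icc 0 T) :
    ∑ e, ∫ x in (0 : ℝ)..(ℓ e), a e * (soleps.u e x t - sol.u e x t
        - d e t * boundaryLayer (ℓ e) (b e / eps e) x) ^ 2 ≤
      (∑ e, eps e * (ℓ e * ((M e + M e / ℓ e) ^ 2 / 2) + a e * M e ^ 2 / b e))
        * Real.exp T := by
  set ψ : E → ℝ → ℝ → ℝ := fun e x s => soleps.u e x s - sol.u e x s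
    - d e s * boundaryLayer (ℓ e) (b e / eps e) x with hψ
  set ψt : E → ℝ → ℝ → ℝ := fun e x s => soleps.ut e x s - sol.ut e x s
    - d' e s * boundaryLayer (ℓ e) (b e / eps e) x with hψt
  have snd : ∀ {f : ℝ → ℝ} (L : ℝ), ContinuousOn f (Set.Icc 0 T) →
      ContinuousOn (fun p : ℝ × ℝ => f p.2) (Set.Icc 0 L ×ˢ Set.Icc 0 T) := fun L hf =>
    hf.comp continuousOn_snd fun p hp => hp.2
  have layer : ∀ e, ContinuousOn (fun p : ℝ × ℝ => boundaryLayer (ℓ e) (b e / eps e) p.1)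
      (Set.Icc 0 (ℓ e) ×ˢ Set.Icc 0 T) := fun e =>
    ((continuous_boundaryLayer _ _).comp continuous_fst).continuousOn
  have cd : ∀ e, ContinuousOn (d e) (Set.Icc 0 T) := fun e s hs =>
    (dd e s hs).continuousWithinAt
  have cψ : ∀ e, ContinuousOn (fun p : ℝ × ℝ => ψ e p.1 p.2) (Set.Icc 0 (ℓ e) ×ˢ Set.Icc 0 T) :=
    fun e => ((soleps.cont_u e).sub (sol.cont_u e)).sub ((snd _ (cd e)).mul (layer e))
  have cψt : ∀ e, ContinuousOn (fun p : ℝ × ℝ => ψt e p.1 p.2)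
      (Set.Icc 0 (ℓ e) ×ˢ Set.Icc 0 T) :=
    fun e => ((soleps.cont_ut e).sub (sol.cont_ut e)).sub ((snd _ (cd' e)).mul (layer e))
  have dψ : ∀ e, ∀ x ∈ Set.Icc 0 (ℓ e), ∀ s ∈ Set.Icc 0 T,
      HasDerivWithinAt (fun r => ψ e x r) (ψt e x s) (Set.Icc 0 T) s := fun e x hx s hs =>
    ((soleps.hasDeriv_t e x hx s hs).sub (sol.hasDeriv_t e x hx s hs)).sub
      ((dd e s hs).mul_const _)
  have cF : ∀ e, ContinuousOn (fun p : ℝ × ℝ => a e * ψ e p.1 p.2 ^ 2)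
      (Set.Icc 0 (ℓ e) ×ˢ Set.Icc 0 T) := fun e => ((cψ e).pow 2).const_mul _
  have cF' : ∀ e, ContinuousOn (fun p : ℝ × ℝ => 2 * a e * ψ e p.1 p.2 * ψt e p.1 p.2)
      (Set.Icc 0 (ℓ e) ×ˢ Set.Icc 0 T) := fun e => ((cψ e).const_mul _).mul (cψt e)
  have dF : ∀ e, ∀ x ∈ Set.Icc 0 (ℓ e), ∀ s ∈ Set.Icc 0 T,
      HasDerivWithinAt (fun r => a e * ψ e x r ^ 2) (2 * a e * ψ e x s * ψt e x s)
        (Set.Icc 0 T) s := fun e x hx s hs =>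
    (((dψ e x hx s hs).pow 2).const_mul (a e)).congr_deriv (by push_cast; ring)
  have slice : ∀ {f : ℝ → ℝ → ℝ} {L s : ℝ},
      ContinuousOn (fun p : ℝ × ℝ => f p.1 p.2) (Set.Icc 0 L ×ˢ Set.Icc 0 T) →
      s ∈ Set.Icc 0 T → ContinuousOn (fun x => f x s) (Set.Icc 0 L) := fun {_ _ s} hf hs =>
    hf.comp (f := fun x => (x, s)) (by fun_prop) fun x hx => ⟨hx, hs⟩
  refine le_mul_exp_of_deriv_le
    (y := fun s => ∑ e, ∫ x in (0 : ℝ)..(ℓ e), a e * ψ e x s ^ 2)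
    (y' := fun s => ∑ e, ∫ x in (0 : ℝ)..(ℓ e), 2 * a e * ψ e x s * ψt e x s)
    (continuousOn_finsetSum _ fun e _ =>
      continuousOn_integral_of_continuousOn_prod (hℓ e).le (cF e)) ?_ ?_ ?_ ?_ ht
  · exact fun s hs => HasDerivAt.fun_sum fun e _ =>
      hasDerivAt_integral_of_continuousOn_prod (hℓ e).le (cF e) (cF' e) (dF e) hs
  · intro s hs
    have hs' := Set.Ioo_subset_Icc_self hs
    refine (Finset.sum_le_sum fun e _ => edge_energy_le (ha e) (hb e) (heps e) (hℓ e)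
      (slice (soleps.cont_u e) hs') (slice (soleps.cont_ux e) hs')
      (slice (soleps.cont_uxx e) hs') (slice (soleps.cont_ut e) hs')
      (slice (sol.cont_u e) hs') (slice (sol.cont_ux e) hs') (slice (sol.cont_ut e) hs')
      (soleps.hasDeriv_x e s hs') (soleps.hasDeriv_xx e s hs') (sol.hasDeriv_x e s hs')
      (fun x hx => soleps.pde e x hx s hs') (fun x hx => sol.pde e x hx s hs')
      (hMx e s hs') (hMd e s hs') (hMd' e s hs')).trans ?_
    rw [Finset.sum_add_distrib, Finset.sum_add_distrib,
      sum_boundary_terms_eq_zero hne hdeg hflow sol soleps hs' (fun v hv => hin v hv s hs')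
        (fun v hv => hbd v hv s hs') (fun e => hd e s), zero_add]
  · refine Finset.sum_eq_zero fun e _ => ?_
    have h0T : (0 : ℝ) ∈ Set.Icc 0 T := ⟨le_rfl, ht.1.trans ht.2⟩
    rw [intervalIntegral.integral_congr (g := fun _ => 0), intervalIntegral.integral_zero]
    intro x hx
    rw [Set.uIcc_of_le (hℓ e).le] at hx
    simp [hψ, hd0, soleps.init e x hx, sol.init e x hx]
  · refine Finset.sum_nonneg fun e _ => ?_
    have := hℓ e
    have := ha e
    have := hb e
    have := heps e
    positivity

end Network

/-- **Theorem 3.4 (main asymptotic estimate).**  Let `u_ε` be the classical solution of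
the convection–diffusion network problem and `u` the classical solution of the limiting
transport problem with the same data.  Then there is a constant `C`, independent of the
diffusion coefficients `0 < εᵉ ≤ 1`, such that
`sup_{t∈[0,T]} ‖u_ε(·,t) − u(·,t)‖_{L²(E)} ≤ C √ε` with `ε = maxₑ εᵉ`. -/
theorem cd_transport_asymptotic_estimate
    (E V : Type) [Fintype E] [Fintype V] [DecidableEq E] [DecidableEq V] [Nonempty E]
    (src tgt : E → V) (hne : ∀ e, src e ≠ tgt e)
    (ℓ a b : E → ℝ) (T : ℝ) (hT : 0 < T)
    (hℓ : ∀ e, 0 < ℓ e) (ha : ∀ e, 0 < a e) (hb : ∀ e, 0 < b e)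
    (hdeg : ∀ v : V, 1 ≤ edgeDeg src tgt v)
    (hinout : ∀ v : V, 2 ≤ edgeDeg src tgt v → (∃ e, tgt e = v) ∧ (∃ e, src e = v))
    (hflow : ∀ v : V, 2 ≤ edgeDeg src tgt v → ∑ e, b e * inc src tgt e v = 0)
    (u0 : E → ℝ → ℝ) (hu0 : ∀ e, ContDiffOn ℝ 2 (u0 e) (Set.Icc 0 (ℓ e)))
    (uhat0 : V → ℝ)
    (hu0cont : ∀ (v : V) (e : E), (src e = v ∨ tgt e = v) →
      u0 e (endCoord src ℓ e v) = uhat0 v)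
    (g : V → ℝ → ℝ) (hg : ∀ v, ContDiffOn ℝ 2 (g v) (Set.Icc 0 T))
    (hcompat : ∀ v : V, edgeDeg src tgt v = 1 → g v 0 = uhat0 v)
    (sol : TSol E V src tgt ℓ a b T u0 g) :
    ∃ C : ℝ, ∀ eps : E → ℝ, (∀ e, 0 < eps e ∧ eps e ≤ 1) →
      (∀ v : V, 2 ≤ edgeDeg src tgt v →
        ∑ e, (b e * u0 e (endCoord src ℓ e v)
            - eps e * derivWithin (u0 e) (Set.Icc 0 (ℓ e)) (endCoord src ℓ e v))
          * inc src tgt e v = 0) →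
      ∀ soleps : CDSol E V src tgt ℓ a b eps T u0 g,
        ∀ t ∈ Set.Icc (0 : ℝ) T,
          Real.sqrt (∑ e, ∫ x in (0 : ℝ)..(ℓ e), (soleps.u e x t - sol.u e x t) ^ 2)
            ≤ C * Real.sqrt (Finset.univ.sup' Finset.univ_nonempty eps) := by
  obtain ⟨h, h', ch', dh, hin, hbd⟩ :=
    sol.exists_nodal_values hT hℓ (fun v hv => (hinout v hv).2) hg
  have hℓmem : ∀ e, ℓ e ∈ Set.Icc 0 (ℓ e) := fun e => ⟨(hℓ e).le, le_rfl⟩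
  have h0T : (0 : ℝ) ∈ Set.Icc 0 T := ⟨le_rfl, hT.le⟩
  set d : E → ℝ → ℝ := fun e t => h (tgt e) t - sol.u e (ℓ e) t with hd
  set d' : E → ℝ → ℝ := fun e t => h' (tgt e) t - sol.ut e (ℓ e) t with hd'
  have dd : ∀ e, ∀ t ∈ Set.Icc 0 T, HasDerivWithinAt (d e) (d' e t) (Set.Icc 0 T) t :=
    fun e t ht => (dh (tgt e) t ht).sub (sol.hasDeriv_t e (ℓ e) (hℓmem e) t ht)
  have cd : ∀ e, ContinuousOn (d e) (Set.Icc 0 T) := fun e t ht =>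
    (dd e t ht).continuousWithinAt
  have cd' : ∀ e, ContinuousOn (d' e) (Set.Icc 0 T) := fun e =>
    (ch' (tgt e)).sub ((sol.cont_ut e).comp (f := fun t => (ℓ e, t)) (by fun_prop)
      fun t ht => ⟨hℓmem e, ht⟩)
  have hd0 : ∀ e, d e 0 = 0 := by
    intro e
    have h1 : sol.u e (ℓ e) 0 = uhat0 (tgt e) := by
      rw [sol.init e _ (hℓmem e), ← hu0cont (tgt e) e (Or.inr rfl), endCoord, if_neg (hne e)]
    have h2 : h (tgt e) 0 = uhat0 (tgt e) := by
      by_cases hv : 2 ≤ edgeDeg src tgt (tgt e)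
      · obtain ⟨e', he'⟩ := (hinout _ hv).2
        rw [hin _ hv 0 h0T, ← he', ← sol.inflow_value e' 0 h0T,
          sol.init e' 0 ⟨le_rfl, (hℓ e').le⟩, ← hu0cont (src e') e' (Or.inl rfl), endCoord,
          if_pos rfl]
      · have hv1 : edgeDeg src tgt (tgt e) = 1 := by
          have := hdeg (tgt e)
          omega
        rw [hbd _ hv1 0 h0T, hcompat _ hv1]
    simp [hd, h1, h2]
  have bounds : ∀ e, ∃ M : ℝ, (∀ t ∈ Set.Icc 0 T, ∀ x ∈ Set.Icc 0 (ℓ e), |sol.ux e x t| ≤ M) ∧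
      (∀ t ∈ Set.Icc 0 T, |d e t| ≤ M) ∧ (∀ t ∈ Set.Icc 0 T, |d' e t| ≤ M) := by
    intro e
    obtain ⟨M1, h1⟩ := (isCompact_Icc.prod isCompact_Icc).exists_bound_of_continuousOn
      (sol.cont_ux e)
    obtain ⟨M2, h2⟩ := isCompact_Icc.exists_bound_of_continuousOn (cd e)
    obtain ⟨M3, h3⟩ := isCompact_Icc.exists_bound_of_continuousOn (cd' e)
    refine ⟨max M1 (max M2 M3), fun t ht x hx => ?_, fun t ht => ?_, fun t ht => ?_⟩
    · exact (h1 (x, t) ⟨hx, ht⟩).trans (le_max_left _ _)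
    · exact (h2 t ht).trans ((le_max_left _ _).trans (le_max_right _ _))
    · exact (h3 t ht).trans ((le_max_right _ _).trans (le_max_right _ _))
  choose M hMx hMd hMd' using bounds
  set K : E → ℝ := fun e => ℓ e * ((M e + M e / ℓ e) ^ 2 / 2) + a e * M e ^ 2 / b e with hK
  have hK0 : ∀ e, 0 ≤ K e := fun e => by
    have := hℓ e
    have := ha e
    have := hb e
    positivity
  set A : ℝ := ∑ e, 2 / a e with hA
  have hA0 : ∀ e, 0 ≤ 2 / a e := fun e => (div_pos two_pos (ha e)).le
  refine ⟨Real.sqrt (A * ((∑ e, K e) * Real.exp T) + ∑ e, 2 * M e ^ 2 / b e), ?_⟩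
  intro eps heps _ soleps t ht
  have henergy := corrected_error_energy_le hne hℓ ha hb (fun e => (heps e).1) hdeg hflow sol
    soleps hin hbd (fun _ _ => rfl) hd0 cd' dd hMx hMd hMd' ht
  set ε := Finset.univ.sup' Finset.univ_nonempty eps with hε
  have hle : ∀ e, eps e ≤ ε := fun e => Finset.le_sup' eps (Finset.mem_univ e)
  have hε0 : 0 ≤ ε := (heps (Classical.arbitrary E)).1.le.trans (hle _)
  set ψ : E → ℝ → ℝ := fun e x => soleps.u e x t - sol.u e x t
    - d e t * boundaryLayer (ℓ e) (b e / eps e) x with hψ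
  have hI0 : ∀ e, 0 ≤ ∫ x in (0 : ℝ)..(ℓ e), a e * ψ e x ^ 2 := fun e =>
    intervalIntegral.integral_nonneg (hℓ e).le fun x _ => mul_nonneg (ha e).le (sq_nonneg _)
  have hedge : ∀ e, ∫ x in (0 : ℝ)..(ℓ e), (soleps.u e x t - sol.u e x t) ^ 2 ≤
      A * (∫ x in (0 : ℝ)..(ℓ e), a e * ψ e x ^ 2) + ε * (2 * M e ^ 2 / b e) := by
    intro e
    have cη : ContinuousOn (fun x => soleps.u e x t - sol.u e x t) (Set.Icc 0 (ℓ e)) :=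
      ((soleps.cont_u e).sub (sol.cont_u e)).comp (f := fun x => (x, t)) (by fun_prop)
        fun x hx => ⟨hx, ht⟩
    have cκ : ContinuousOn (boundaryLayer (ℓ e) (b e / eps e)) (Set.Icc 0 (ℓ e)) :=
      (continuous_boundaryLayer _ _).continuousOn
    have cψ : ContinuousOn (ψ e) (Set.Icc 0 (ℓ e)) := cη.sub (cκ.const_mul (d e t))
    have integ : ∀ {f : ℝ → ℝ}, ContinuousOn f (Set.Icc 0 (ℓ e)) →
        IntervalIntegrable f MeasureTheory.volume 0 (ℓ e) := fun h =>
      ContinuousOn.intervalIntegrable (by rwa [Set.uIcc_of_le (hℓ e).le])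
    have hd2 : d e t ^ 2 ≤ M e ^ 2 := by
      rw [← sq_abs]
      exact pow_le_pow_left₀ (abs_nonneg _) (hMd e t ht) 2
    have hκ := integral_boundaryLayer_sq_le (hℓ e) (div_pos (hb e) (heps e).1)
    rw [one_div_div] at hκ
    have hκ0 : 0 ≤ ∫ x in (0 : ℝ)..(ℓ e), boundaryLayer (ℓ e) (b e / eps e) x ^ 2 :=
      intervalIntegral.integral_nonneg (hℓ e).le fun x _ => sq_nonneg _
    calc _ ≤ ∫ x in (0 : ℝ)..(ℓ e), (2 / a e * (a e * ψ e x ^ 2)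
          + 2 * d e t ^ 2 * boundaryLayer (ℓ e) (b e / eps e) x ^ 2) := by
          refine intervalIntegral.integral_mono_on (hℓ e).le (integ (by fun_prop))
            (integ (by fun_prop)) fun x _ => ?_
          have h1 : 2 / a e * (a e * ψ e x ^ 2) = 2 * ψ e x ^ 2 := by
            have := (ha e).ne'
            field_simp
          rw [h1]
          have h2 : soleps.u e x t - sol.u e x t =
            ψ e x + d e t * boundaryLayer (ℓ e) (b e / eps e) x := by simp [hψ]
          rw [h2]
          linarith [sq_nonneg (ψ e x - d e t * boundaryLayer (ℓ e) (b e / eps e) x)]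
      _ = 2 / a e * (∫ x in (0 : ℝ)..(ℓ e), a e * ψ e x ^ 2) + 2 * d e t ^ 2
          * ∫ x in (0 : ℝ)..(ℓ e), boundaryLayer (ℓ e) (b e / eps e) x ^ 2 := by
          rw [intervalIntegral.integral_add (integ (by fun_prop)) (integ (by fun_prop)),
            intervalIntegral.integral_const_mul (2 / a e),
            intervalIntegral.integral_const_mul (2 * d e t ^ 2)]
      _ ≤ A * (∫ x in (0 : ℝ)..(ℓ e), a e * ψ e x ^ 2) + 2 * M e ^ 2 * (ε / b e) := by
          have hAe : 2 / a e ≤ A :=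
            Finset.single_le_sum (f := fun e => 2 / a e) (fun e _ => hA0 e) (Finset.mem_univ e)
          have hκ' := hκ.trans (div_le_div_of_nonneg_right (hle e) (hb e).le)
          have := hI0 e
          gcongr
      _ = _ := by ring
  have hAnn : 0 ≤ A := Finset.sum_nonneg fun e _ => hA0 e
  have hKsum : ∑ e, eps e * K e ≤ ε * ∑ e, K e := by
    rw [Finset.mul_sum]
    exact Finset.sum_le_sum fun e _ => mul_le_mul_of_nonneg_right (hle e) (hK0 e)
  have hmain : ∑ e, ∫ x in (0 : ℝ)..(ℓ e), (soleps.u e x t - sol.u e x t) ^ 2 ≤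
      (A * ((∑ e, K e) * Real.exp T) + ∑ e, 2 * M e ^ 2 / b e) * ε := by
    calc _ ≤ ∑ e, (A * (∫ x in (0 : ℝ)..(ℓ e), a e * ψ e x ^ 2) + ε * (2 * M e ^ 2 / b e)) :=
          Finset.sum_le_sum fun e _ => hedge e
      _ = A * ∑ e, (∫ x in (0 : ℝ)..(ℓ e), a e * ψ e x ^ 2)
          + ε * ∑ e, 2 * M e ^ 2 / b e := by
          rw [Finset.sum_add_distrib, Finset.mul_sum, Finset.mul_sum]
      _ ≤ A * ((ε * ∑ e, K e) * Real.exp T) + ε * ∑ e, 2 * M e ^ 2 / b e := by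
          have h2 : (∑ e, eps e * K e) * Real.exp T ≤ (ε * ∑ e, K e) * Real.exp T := by gcongr
          have h3 := mul_le_mul_of_nonneg_left (henergy.trans h2) hAnn
          linarith
      _ = _ := by ring
  rw [← Real.sqrt_mul' _ hε0]
  exact Real.sqrt_le_sqrt hmain
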